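/- For every integer n ≥ 7, T(2n,7) = (33/1024)·t(2n) − (15/512)·t(2)·t(2n-2) + (1/256)·t(4)·t(2n-4) − (1/21504)·t(6)·t(2n-6), where t(2m) = Σ_{k≥1} 1/(2k-1)^{2m}. -/

import Mathlib

open scoped BigOperators

/-- Depth-one multiple t-value: `t1 m = t(2m) = ∑_{k ≥ 1} 1/(2k-1)^{2m}`. -/
noncomputable def t1 (m : ℕ) : ℝ := ∑' k : ℕ, 1 / (2 * (k : ℝ) + 1) ^ (2 * m)

/-- Multiple t-value `t(s₀, …, s_{d-1})`, summed over `n₀ > n₁ > ⋯ > n_{d-1} ≥ 1`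
(encoded via `f i = n_i - 1`, so the odd number `2 n_i - 1` is `2 (f i) + 1`). -/
noncomputable def mtv (d : ℕ) (s : Fin d → ℕ) : ℝ :=
  ∑' f : {f : Fin d → ℕ // StrictAnti f}, ∏ i, 1 / (2 * (f.1 i : ℝ) + 1) ^ (s i)

/-- `Tsum n d = T(2n, d)`: the sum of all multiple t-values of weight `2n` and
depth `d` with all arguments even. -/
noncomputable def Tsum (n d : ℕ) : ℝ :=
  ∑ j ∈ (Finset.Nat.antidiagonalTuple d n).filter (fun j => ∀ i, 1 ≤ j i),
    mtv d (fun i => 2 * j i)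

open Finset Filter Topology PowerSeries

/-- The power series `∑_{j ≥ 1} a^j X^j`. -/
noncomputable def geomTail (a : ℝ) : ℝ⟦X⟧ := PowerSeries.mk fun j => if j = 0 then 0 else a ^ j

/-- The elementary symmetric function of degree `m` in the values of `a` on `s`. -/
noncomputable def esymmOn (a : ℕ → ℝ) (s : Finset ℕ) (m : ℕ) : ℝ :=
  ∑ t ∈ s.powersetCard m, ∏ k ∈ t, a k

/-- The elementary symmetric function of degree `d` in the power series `geomTail (a k)`, `k ∈ s`.
-/
noncomputable def esymmGeom (a : ℕ → ℝ) (s : Finset ℕ) (d : ℕ) : ℝ⟦X⟧ :=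
  ∑ t ∈ s.powersetCard d, ∏ k ∈ t, geomTail (a k)

lemma geomTail_mul (a : ℝ) : geomTail a * (1 - C a * X) = C a * X := by
  ext n
  rw [mul_sub, mul_one, ← mul_assoc, mul_comm (geomTail a), mul_assoc, map_sub]
  rcases n with _ | _ | n
  · simp [geomTail]
  · simp [geomTail, coeff_succ_mul_X]
  · simp [geomTail, coeff_succ_mul_X]
    ring

lemma sum_powerset_eq_mk (a : ℕ → ℝ) (s : Finset ℕ) (r : ℕ → ℝ) :
    ∑ t ∈ s.powerset, C (r #t) * ∏ k ∈ t, (C (a k) * X) =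
      PowerSeries.mk fun n => r n * esymmOn a s n := by
  ext n
  have h (t : Finset ℕ) : C (r #t) * ∏ k ∈ t, (C (a k) * X) =
      PowerSeries.monomial #t (r #t * ∏ k ∈ t, a k) := by
    rw [prod_mul_distrib, prod_const, ← map_prod, ← mul_assoc, ← map_mul,
      PowerSeries.monomial_eq_C_mul_X_pow]
  simp_rw [h, map_sum, PowerSeries.coeff_monomial, coeff_mk, esymmOn, mul_sum, ← sum_filter]
  refine sum_congr ?_ ?_
  · ext t
    simp [mem_powersetCard, eq_comm]
  · intro t ht
    rw [(mem_powersetCard.mp ht).2]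

lemma esymmGeom_mul_prod (a : ℕ → ℝ) (s : Finset ℕ) (d : ℕ) :
    esymmGeom a s d * ∏ k ∈ s, (1 - C (a k) * X) =
      PowerSeries.mk fun n => (-1) ^ (n - d) * n.choose d * esymmOn a s n := by
  rw [← sum_powerset_eq_mk a s fun n => (-1) ^ (n - d) * n.choose d]
  have key : (∏ k ∈ s, (1 + Polynomial.X * Polynomial.C (geomTail (a k)))) *
      Polynomial.C (∏ k ∈ s, (1 - C (a k) * X)) =
      ∏ k ∈ s, (1 + (Polynomial.X + Polynomial.C (-1)) * Polynomial.C (C (a k) * X)) := by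
    rw [map_prod, ← prod_mul_distrib]
    refine prod_congr rfl fun k _ => ?_
    have h := congrArg Polynomial.C (geomTail_mul (a k))
    simp only [map_mul, map_sub, map_neg, map_one] at h ⊢
    linear_combination Polynomial.X * h
  have h := congrArg (Polynomial.coeff · d) key
  simp only [prod_one_add, prod_mul_distrib (f := fun _ => (Polynomial.X : Polynomial ℝ⟦X⟧)),
    prod_mul_distrib (f := fun _ => (Polynomial.X + Polynomial.C (-1) : Polynomial ℝ⟦X⟧)),
    prod_const, Polynomial.coeff_mul_C, Polynomial.finsetSum_coeff, ← map_prod Polynomial.C,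
    Polynomial.coeff_X_pow, Polynomial.coeff_X_add_C_pow, ite_mul, one_mul, zero_mul] at h
  rw [esymmGeom, powersetCard_eq_filter, sum_filter]
  simp_rw [eq_comm (a := #_)]
  rw [h]
  refine sum_congr rfl fun t _ => ?_
  simp

lemma prod_one_sub_eq_mk (a : ℕ → ℝ) (s : Finset ℕ) :
    ∏ k ∈ s, (1 - C (a k) * X) = PowerSeries.mk fun n => (-1) ^ n * esymmOn a s n := by
  simpa [esymmGeom] using esymmGeom_mul_prod a s 0

lemma esymmGeom_coeff_self (a : ℕ → ℝ) (s : Finset ℕ) (d : ℕ) :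
    coeff d (esymmGeom a s d) = esymmOn a s d := by
  rw [esymmGeom, esymmOn, map_sum]
  refine sum_congr rfl fun t ht => ?_
  have h : ∏ k ∈ t, geomTail (a k) =
      (∏ k ∈ t, PowerSeries.mk fun j => a k ^ (j + 1)) * X ^ d := by
    rw [← (mem_powersetCard.mp ht).2, ← prod_const, ← prod_mul_distrib]
    refine prod_congr rfl fun k _ => ?_
    ext (_ | n) <;> simp [geomTail, coeff_succ_mul_X]
  rw [h, coeff_mul_X_pow', if_pos le_rfl, Nat.sub_self, coeff_zero_eq_constantCoeff, map_prod]
  simp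

lemma coeff_prod_geomTail {d : ℕ} (b : Fin d → ℝ) (n : ℕ) :
    coeff n (∏ i, geomTail (b i)) =
      ∑ j ∈ (Finset.Nat.antidiagonalTuple d n).filter (fun j => ∀ i, 1 ≤ j i), ∏ i, b i ^ j i := by
  rw [PowerSeries.coeff_prod, sum_filter]
  refine sum_bij' (fun l _ => l) (fun j _ => Finsupp.equivFunOnFinite.symm j) ?_ ?_ ?_ ?_ ?_
  · intro l hl
    simpa [Finset.Nat.mem_antidiagonalTuple] using (mem_finsuppAntidiag.mp hl).1
  · intro j hj
    simpa [mem_finsuppAntidiag, Finset.Nat.mem_antidiagonalTuple] using hj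
  · intro l _
    ext; simp
  · intro j _
    ext; simp
  · intro l _
    simp only [geomTail, coeff_mk]
    split_ifs with h
    · exact prod_congr rfl fun i _ => if_neg (Nat.one_le_iff_ne_zero.mp (h i))
    · push Not at h
      obtain ⟨i, hi⟩ := h
      exact prod_eq_zero (mem_univ i) (if_pos (by omega))

lemma summable_prod_comp {a : ℕ → ℝ} (ha : Summable a) (h0 : ∀ k, 0 ≤ a k) (d : ℕ) :
    Summable fun f : Fin d → ℕ => ∏ i, a (f i) := by
  refine summable_of_sum_le (c := (∑' k, a k) ^ d) (fun f => prod_nonneg fun i _ => h0 _) ?_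
  intro u
  obtain ⟨s, hs⟩ : ∃ s : Finset ℕ, u ⊆ Fintype.piFinset fun _ => s := by
    refine ⟨u.biUnion fun f => univ.image f, fun f hf => ?_⟩
    simp only [Fintype.mem_piFinset, mem_biUnion, mem_image, mem_univ, true_and]
    exact fun i => ⟨f, hf, i, rfl⟩
  calc ∑ f ∈ u, ∏ i, a (f i) ≤ ∑ f ∈ Fintype.piFinset fun _ => s, ∏ i, a (f i) :=
        sum_le_sum_of_subset_of_nonneg hs fun f _ _ => prod_nonneg fun i _ => h0 _
    _ = (∑ k ∈ s, a k) ^ d := by simp [← prod_univ_sum]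
    _ ≤ _ := pow_le_pow_left₀ (sum_nonneg fun k _ => h0 k) (ha.sum_le_tsum s fun k _ => h0 k) d

/-- The squares of the reciprocals of the odd positive integers. -/
noncomputable def oddInvSq (k : ℕ) : ℝ := 1 / (2 * (k : ℝ) + 1) ^ 2

lemma oddInvSq_nonneg (k : ℕ) : 0 ≤ oddInvSq k := by
  unfold oddInvSq; positivity

lemma oddInvSq_le_one (k : ℕ) : oddInvSq k ≤ 1 := by
  unfold oddInvSq
  rw [div_le_one (by positivity)]
  exact one_le_pow₀ (by linarith [Nat.cast_nonneg (α := ℝ) k])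

lemma summable_oddInvSq : Summable oddInvSq := by
  have h := (Real.summable_one_div_nat_pow (p := 2)).mpr (by norm_num)
  have h2 := h.comp_injective (i := fun k : ℕ => 2 * k + 1) (fun x y hxy => by simpa using hxy)
  refine h2.congr fun k => ?_
  simp [oddInvSq]

lemma one_div_odd_pow (k j : ℕ) : 1 / (2 * (k : ℝ) + 1) ^ (2 * j) = oddInvSq k ^ j := by
  rw [oddInvSq, div_pow, one_pow, pow_mul]

lemma summable_strictAnti_prod {d : ℕ} (j : Fin d → ℕ) (hj : ∀ i, 1 ≤ j i) :
    Summable fun f : {f : Fin d → ℕ // StrictAnti f} => ∏ i, oddInvSq (f.1 i) ^ j i := by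
  refine Summable.of_nonneg_of_le (fun f => prod_nonneg fun i _ => pow_nonneg (oddInvSq_nonneg _) _)
    (fun f => prod_le_prod (fun i _ => pow_nonneg (oddInvSq_nonneg _) _) fun i _ => ?_)
    ((summable_prod_comp summable_oddInvSq oddInvSq_nonneg d).subtype _)
  exact pow_le_of_le_one (oddInvSq_nonneg _) (oddInvSq_le_one _) (by have := hj i; omega)

lemma hasSum_Tsum (n d : ℕ) :
    HasSum (fun f : {f : Fin d → ℕ // StrictAnti f} =>
      coeff n (∏ i, geomTail (oddInvSq (f.1 i)))) (Tsum n d) := by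
  simp_rw [coeff_prod_geomTail, Tsum, mtv, one_div_odd_pow]
  exact hasSum_sum fun j hj => (summable_strictAnti_prod j (mem_filter.mp hj).2).hasSum

/-- The strictly decreasing `d`-tuples of natural numbers below `N`. -/
noncomputable def strictAntiBelow (d N : ℕ) : Finset {f : Fin d → ℕ // StrictAnti f} :=
  letI := Classical.decPred fun f : Fin d → ℕ => StrictAnti f
  (Fintype.piFinset fun _ => range N).subtype _

lemma mem_strictAntiBelow {d N : ℕ} {f : {f : Fin d → ℕ // StrictAnti f}} :
    f ∈ strictAntiBelow d N ↔ ∀ i, f.1 i < N := by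
  simp [strictAntiBelow]

lemma tendsto_strictAntiBelow (d : ℕ) : Tendsto (strictAntiBelow d) atTop atTop := by
  refine tendsto_atTop_finset_of_monotone (fun M N h f hf => ?_) fun f => ?_
  · exact mem_strictAntiBelow.mpr fun i => (mem_strictAntiBelow.mp hf i).trans_le h
  · exact ⟨∑ i, f.1 i + 1, mem_strictAntiBelow.mpr fun i =>
      Nat.lt_succ_of_le (single_le_sum (f := f.1) (fun _ _ => Nat.zero_le _) (mem_univ i))⟩

lemma sum_strictAntiBelow (d N : ℕ) (F : ℕ → ℝ⟦X⟧) :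
    ∑ f ∈ strictAntiBelow d N, ∏ i, F (f.1 i) = ∑ t ∈ (range N).powersetCard d, ∏ k ∈ t, F k := by
  refine sum_bij (fun f _ => univ.image f.1) ?_ ?_ ?_ ?_
  · intro f hf
    rw [mem_powersetCard, card_image_of_injective _ f.2.injective, card_univ, Fintype.card_fin]
    refine ⟨fun k hk => ?_, rfl⟩
    obtain ⟨i, -, rfl⟩ := mem_image.mp hk
    exact mem_range.mpr (mem_strictAntiBelow.mp hf i)
  · intro f _ g _ h
    refine Subtype.ext ((f.2.range_inj g.2).mp ?_)
    simpa using congrArg (fun s : Finset ℕ => (s : Set ℕ)) h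
  · intro t ht
    obtain ⟨hsub, hcard⟩ := mem_powersetCard.mp ht
    refine ⟨⟨fun i => t.orderEmbOfFin hcard i.rev,
      (t.orderEmbOfFin hcard).strictMono.comp_strictAnti Fin.rev_strictAnti⟩, ?_, ?_⟩
    · exact mem_strictAntiBelow.mpr fun i =>
        mem_range.mp (hsub (t.orderEmbOfFin_mem hcard i.rev))
    · apply coe_injective
      rw [coe_image, coe_univ, Set.image_univ]
      change Set.range (t.orderEmbOfFin hcard ∘ Fin.rev) = t
      rw [Fin.rev_surjective.range_comp, range_orderEmbOfFin]
  · intro f _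
    rw [prod_image fun i _ j _ h => f.2.injective h]

lemma tendsto_esymmGeom (n d : ℕ) :
    Tendsto (fun N => coeff n (esymmGeom oddInvSq (range N) d)) atTop (𝓝 (Tsum n d)) := by
  refine ((hasSum_Tsum n d).comp (tendsto_strictAntiBelow d)).congr fun N => ?_
  rw [Function.comp_apply, ← map_sum, sum_strictAntiBelow d N fun k => geomTail (oddInvSq k),
    esymmGeom]

lemma tendsto_esymmOn (m : ℕ) :
    Tendsto (fun N => esymmOn oddInvSq (range N) m) atTop (𝓝 (Tsum m m)) := by
  simpa only [esymmGeom_coeff_self] using tendsto_esymmGeom m m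

/-- The generating function identity `(∑ₙ T(2n, d) Xⁿ) (∑ₙ (-1)ⁿ eₙ Xⁿ) = ∑ₙ (-1)ⁿ⁻ᵈ C(n, d) eₙ Xⁿ`,
where `eₙ = T(2n, n)`. -/
lemma mk_Tsum_mul (d : ℕ) :
    (PowerSeries.mk fun n => Tsum n d) * (PowerSeries.mk fun n => (-1) ^ n * Tsum n n) =
      PowerSeries.mk fun n => (-1) ^ (n - d) * n.choose d * Tsum n n := by
  ext n
  simp only [coeff_mul, coeff_mk]
  refine tendsto_nhds_unique (tendsto_finsetSum _ fun p _ =>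
    (tendsto_esymmGeom p.1 d).mul ((tendsto_esymmOn p.2).const_mul ((-1) ^ p.2)))
    (((tendsto_esymmOn n).const_mul ((-1) ^ (n - d) * (n.choose d : ℝ))).congr fun N => ?_)
  have h := congrArg (coeff n) (esymmGeom_mul_prod oddInvSq (range N) d)
  rw [prod_one_sub_eq_mk, coeff_mul] at h
  simpa using h.symm

lemma prod_range_two_mul (f : ℕ → ℝ) (N : ℕ) :
    ∏ j ∈ range (2 * N), f j = (∏ k ∈ range N, f (2 * k)) * ∏ k ∈ range N, f (2 * k + 1) := by
  induction N with
  | zero => simp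
  | succ N ih =>
    rw [Nat.mul_succ, prod_range_succ, prod_range_succ, ih, prod_range_succ, prod_range_succ]
    ring

/-- Euler's product for the cosine. -/
lemma tendsto_euler_cos_prod {z : ℝ} (h0 : 0 < z) (h1 : z < 1) :
    Tendsto (fun N => ∏ k ∈ range N, (1 - oddInvSq k * (2 * z) ^ 2)) atTop
      (𝓝 (Real.cos (Real.pi * z))) := by
  have hs : Real.sin (Real.pi * z) ≠ 0 := by
    refine (Real.sin_pos_of_pos_of_lt_pi (by positivity) ?_).ne'
    nlinarith [Real.pi_pos]
  have hB := Real.tendsto_euler_sin_prod z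
  have hAB := (Real.tendsto_euler_sin_prod (2 * z)).comp
    (tendsto_id.const_mul_atTop' (r := 2) (by norm_num))
  have h := (hAB.div hB hs).div_const 2
  have hlim : Real.sin (Real.pi * (2 * z)) / Real.sin (Real.pi * z) / 2 =
      Real.cos (Real.pi * z) := by
    rw [mul_left_comm, Real.sin_two_mul]
    field_simp
  rw [hlim] at h
  refine h.congr' ?_
  filter_upwards [hB.eventually_ne hs] with N hN
  simp only [Pi.div_apply, Function.comp_apply, id]
  rw [prod_range_two_mul, div_div, div_eq_iff (by simpa using hN)]
  have e1 : ∏ k ∈ range N, (1 - (2 * z) ^ 2 / (((2 * k + 1 : ℕ) : ℝ) + 1) ^ 2) =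
      ∏ k ∈ range N, (1 - z ^ 2 / ((k : ℝ) + 1) ^ 2) := by
    refine prod_congr rfl fun k _ => ?_
    push_cast
    rw [show (2 * (k : ℝ) + 1 + 1) = 2 * (k + 1) by ring, mul_pow, mul_pow,
      mul_div_mul_left _ _ (by norm_num)]
  have e2 : ∏ k ∈ range N, (1 - (2 * z) ^ 2 / (((2 * k : ℕ) : ℝ) + 1) ^ 2) =
      ∏ k ∈ range N, (1 - oddInvSq k * (2 * z) ^ 2) := by
    refine prod_congr rfl fun k _ => ?_
    rw [oddInvSq]
    push_cast
    ring
  rw [e1, e2]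
  ring

lemma prod_one_sub_mul_eq_sum (a : ℕ → ℝ) (s : Finset ℕ) (x : ℝ) :
    ∏ k ∈ s, (1 - a k * x) = ∑' m, (-1) ^ m * esymmOn a s m * x ^ m := by
  rw [tsum_eq_sum (s := range (#s + 1)) fun m hm => ?_]
  · simp_rw [sub_eq_add_neg]
    rw [prod_one_add, sum_powerset]
    refine sum_congr rfl fun m _ => ?_
    rw [esymmOn, mul_sum, sum_mul]
    refine sum_congr rfl fun t ht => ?_
    simp_rw [← mul_neg]
    rw [prod_mul_distrib, prod_const, (mem_powersetCard.mp ht).2, neg_pow x]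
    ring
  · rw [esymmOn, powersetCard_eq_empty.mpr (by simpa using hm)]
    simp

lemma esymmOn_nonneg {a : ℕ → ℝ} (h0 : ∀ k, 0 ≤ a k) (s : Finset ℕ) (m : ℕ) :
    0 ≤ esymmOn a s m :=
  sum_nonneg fun _ _ => prod_nonneg fun k _ => h0 k

lemma esymmOn_le {a : ℕ → ℝ} (ha : Summable a) (h0 : ∀ k, 0 ≤ a k) (s : Finset ℕ) (m : ℕ) :
    esymmOn a s m ≤ Real.exp (∑' k, a k) :=
  calc esymmOn a s m ≤ ∑ t ∈ s.powerset, ∏ k ∈ t, a k :=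
        sum_le_sum_of_subset_of_nonneg (fun _ ht => mem_powerset.mpr (mem_powersetCard.mp ht).1)
          fun _ _ _ => prod_nonneg fun k _ => h0 k
    _ = ∏ k ∈ s, (1 + a k) := (prod_one_add s).symm
    _ ≤ Real.exp (∑ k ∈ s, a k) := Real.prod_one_add_le_exp_sum s h0
    _ ≤ _ := Real.exp_le_exp.mpr (ha.sum_le_tsum s fun k _ => h0 k)

lemma tsum_Tsum_self_mul_pow {x : ℝ} (hx0 : 0 < x) (hx1 : x < 1) :
    ∑' m, (-1) ^ m * Tsum m m * x ^ m =
      ∑' m, (-1) ^ m * ((Real.pi ^ 2 / 4) ^ m / (2 * m).factorial) * x ^ m := by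
  set B := Real.exp (∑' k, oddInvSq k)
  have h1 : Tendsto (fun N => ∑' m, (-1) ^ m * esymmOn oddInvSq (range N) m * x ^ m) atTop
      (𝓝 (∑' m, (-1) ^ m * Tsum m m * x ^ m)) := by
    refine tendsto_tsum_of_dominated_convergence (bound := fun m => B * x ^ m)
      ((summable_geometric_of_lt_one hx0.le hx1).mul_left B)
      (fun m => ((tendsto_esymmOn m).const_mul _).mul_const _) (.of_forall fun N m => ?_)
    rw [norm_mul, norm_mul, norm_pow, norm_neg, norm_one, one_pow, one_mul, norm_pow,
      Real.norm_of_nonneg hx0.le, Real.norm_of_nonneg (esymmOn_nonneg oddInvSq_nonneg _ _)]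
    gcongr
    exact esymmOn_le summable_oddInvSq oddInvSq_nonneg _ _
  have hz0 : 0 < √x / 2 := by positivity
  have hz1 : √x / 2 < 1 := by
    have := (Real.sqrt_lt' one_pos).mpr (by simpa using hx1)
    linarith
  have h2 := tendsto_euler_cos_prod hz0 hz1
  have hx : (2 * (√x / 2)) ^ 2 = x := by
    rw [mul_div_cancel₀ _ two_ne_zero, Real.sq_sqrt hx0.le]
  simp_rw [hx, prod_one_sub_mul_eq_sum] at h2
  rw [tendsto_nhds_unique h1 h2, Real.cos_eq_tsum]
  refine tsum_congr fun m => ?_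
  rw [pow_mul, show (Real.pi * (√x / 2)) ^ 2 = Real.pi ^ 2 / 4 * x by
    rw [mul_pow, div_pow, Real.sq_sqrt hx0.le]; ring, mul_pow]
  ring

/-- Two bounded sequences are equal if their power series agree on `(0, 1)`. -/
lemma eq_of_tsum_mul_pow_eq {u v : ℕ → ℝ} {A B : ℝ} (hu : ∀ n, |u n| ≤ A) (hv : ∀ n, |v n| ≤ B)
    (h : ∀ x : ℝ, 0 < x → x < 1 → ∑' n, u n * x ^ n = ∑' n, v n * x ^ n) : u = v := by
  have key {w : ℕ → ℝ} {D : ℝ} (hw : ∀ n, |w n| ≤ D) :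
      HasFPowerSeriesAt (fun x => ∑' n, w n * x ^ n) (FormalMultilinearSeries.ofScalars ℝ w) 0 := by
    have hr : (1 : ENNReal) ≤ (FormalMultilinearSeries.ofScalars ℝ w).radius := by
      refine FormalMultilinearSeries.le_radius_of_bound (r := 1) _ D fun n => ?_
      simpa using hw n
    have := ((FormalMultilinearSeries.ofScalars ℝ w).hasFPowerSeriesOnBall
      (one_pos.trans_le hr)).hasFPowerSeriesAt
    refine this.congr (.of_forall fun x => ?_)
    simp [FormalMultilinearSeries.sum, mul_comm]
  have hU := key hu
  have hV := key hv
  have hfreq : ∃ᶠ x in 𝓝[≠] (0 : ℝ), ∑' n, u n * x ^ n = ∑' n, v n * x ^ n := by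
    have : ∃ᶠ x in 𝓝[>] (0 : ℝ), ∑' n, u n * x ^ n = ∑' n, v n * x ^ n := by
      refine Eventually.frequently ?_
      filter_upwards [Ioo_mem_nhdsGT (zero_lt_one (α := ℝ))] with x hx
      exact h x hx.1 hx.2
    exact this.filter_mono (nhdsGT_le_nhdsNE 0)
  have heq := (hU.analyticAt.frequently_eq_iff_eventually_eq hV.analyticAt).mp hfreq
  have h' := (hU.congr heq).eq_formalMultilinearSeries hV
  funext n
  simpa using congrArg (fun p => FormalMultilinearSeries.coeff p n) h'

lemma Tsum_self (m : ℕ) : Tsum m m = (Real.pi ^ 2 / 4) ^ m / (2 * m).factorial := by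
  have hc : (0 : ℝ) ≤ Real.pi ^ 2 / 4 := by positivity
  have h := eq_of_tsum_mul_pow_eq
    (u := fun m => (-1) ^ m * Tsum m m)
    (v := fun m => (-1) ^ m * ((Real.pi ^ 2 / 4) ^ m / (2 * m).factorial))
    (A := Real.exp (∑' k, oddInvSq k)) (B := Real.exp (Real.pi ^ 2 / 4))
    (fun m => ?_) (fun m => ?_) fun x h0 h1 => tsum_Tsum_self_mul_pow h0 h1
  · simpa using congrFun h m
  · rw [abs_mul, abs_pow, abs_neg, abs_one, one_pow, one_mul, abs_of_nonneg
      (ge_of_tendsto' (tendsto_esymmOn m) fun N => esymmOn_nonneg oddInvSq_nonneg _ _)]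
    exact le_of_tendsto' (tendsto_esymmOn m) fun N =>
      esymmOn_le summable_oddInvSq oddInvSq_nonneg _ _
  · rw [abs_mul, abs_pow, abs_neg, abs_one, one_pow, one_mul, abs_of_nonneg (by positivity)]
    refine le_trans ?_ (Real.pow_div_factorial_le_exp _ hc m)
    gcongr
    omega

lemma t1_eq_Tsum (m : ℕ) (hm : 1 ≤ m) : t1 m = Tsum m 1 := by
  rw [t1, Tsum, Finset.Nat.antidiagonalTuple_one, filter_singleton, if_pos (by simpa using hm),
    sum_singleton, mtv]
  refine (((Equiv.subtypeUnivEquiv fun f => Subsingleton.strictAnti f).trans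
    (Equiv.funUnique (Fin 1) ℕ)).tsum_eq _).symm.trans ?_
  simp

lemma mk_Tsum_seven {c : ℝ} (hc : c = Real.pi ^ 2 / 4) :
    (PowerSeries.mk fun n => Tsum n 7) =
      (C (33 / 1024) + C (-(15 / 1024) * c) * X ^ 1 + C (1 / 1536 * c ^ 2) * X ^ 2 +
        C (-(1 / 322560) * c ^ 3) * X ^ 3) * (PowerSeries.mk fun n => Tsum n 1) +
      (C (-(33 / 2048) * c) * X ^ 1 + C (1 / 512 * c ^ 2) * X ^ 2 +
        C (-(1 / 30720) * c ^ 3) * X ^ 3) := by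
  have hE : (PowerSeries.mk fun n => (-1) ^ n * Tsum n n) ≠ 0 := fun h => by
    simpa [Tsum_self] using congrArg (coeff 0) h
  refine mul_right_cancel₀ hE ?_
  rw [add_mul _ _ (PowerSeries.mk _), mul_assoc _ _ (PowerSeries.mk fun n => (-1) ^ n * Tsum n n),
    mk_Tsum_mul, mk_Tsum_mul]
  ext n
  simp only [Tsum_self, ← hc, add_mul, map_add, mul_assoc (C _), coeff_C_mul,
    PowerSeries.coeff_X_pow_mul', coeff_mk]
  obtain hn | hn := lt_or_ge n 7
  · interval_cases n <;> norm_num [Nat.factorial, Nat.choose] <;> ring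
  · obtain ⟨m, rfl⟩ := Nat.exists_eq_add_of_le' hn
    have hch : ((m + 7).choose 7 : ℝ) =
        (m + 7) * (m + 6) * (m + 5) * (m + 4) * (m + 3) * (m + 2) * (m + 1) / 5040 := by
      rw [Nat.cast_choose_eq_descPochhammer_div]
      simp [descPochhammer_succ_right, Nat.factorial]
      ring
    have hf (k l : ℕ) (h : l = k + 2) : ((l.factorial : ℕ) : ℝ) =
        (k + 2) * (k + 1) * k.factorial := by
      subst h
      push_cast [Nat.factorial_succ]
      ring
    simp only [if_pos (show 1 ≤ m + 7 by omega), if_pos (show 2 ≤ m + 7 by omega),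
      if_pos (show 3 ≤ m + 7 by omega), Nat.choose_one_right, hch,
      show m + 7 - 1 = m + 6 by omega, show m + 7 - 2 = m + 5 by omega,
      show m + 7 - 3 = m + 4 by omega, show m + 7 - 7 = m by omega,
      show m + 6 - 1 = m + 5 by omega, show m + 5 - 1 = m + 4 by omega,
      show m + 4 - 1 = m + 3 by omega]
    rw [hf (2 * (m + 6)) (2 * (m + 7)) (by ring), hf (2 * (m + 5)) (2 * (m + 6)) (by ring),
      hf (2 * (m + 4)) (2 * (m + 5)) (by ring)]
    have := Nat.factorial_pos (2 * (m + 4))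
    push_cast
    field_simp
    ring

lemma Tsum_one_values {c : ℝ} (hc : c = Real.pi ^ 2 / 4) :
    Tsum 1 1 = c / 2 ∧ Tsum 2 1 = c ^ 2 / 6 ∧ Tsum 3 1 = c ^ 3 / 15 := by
  have h (n : ℕ) := congrArg (coeff n) (mk_Tsum_mul 1)
  simp only [coeff_mul, coeff_mk, Tsum_self, ← hc, Finset.Nat.sum_antidiagonal_eq_sum_range_succ_mk]
    at h
  have h0 : Tsum 0 1 = 0 := by simpa using h 0
  have h1 : Tsum 1 1 = c / 2 := by norm_num [Tsum_self, ← hc]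
  have h2 := h 2
  have h3 := h 3
  norm_num [sum_range_succ, Nat.factorial, Nat.choose, h0, h1] at h2 h3
  have h2' : Tsum 2 1 = c ^ 2 / 6 := by linear_combination h2
  exact ⟨h1, h2', by linear_combination h3 + c / 2 * h2'⟩

/-- Sum formula for multiple t-values at even arguments of depth 7. -/
theorem T2n_depth_7 (n : ℕ) (hn : 7 ≤ n) :
    Tsum n 7 = 33 / 1024 * t1 n - 15 / 512 * t1 1 * t1 (n - 1) + 1 / 256 * t1 2 * t1 (n - 2) - 1 / 21504 * t1 3 * t1 (n - 3) := by
  obtain ⟨h1, h2, h3⟩ := Tsum_one_values (c := Real.pi ^ 2 / 4) rfl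
  have h := congrArg (coeff n) (mk_Tsum_seven (c := Real.pi ^ 2 / 4) rfl)
  simp only [add_mul, map_add, mul_assoc (C _), coeff_C_mul, PowerSeries.coeff_X_pow_mul',
    coeff_mk, PowerSeries.coeff_X_pow, if_pos (show 1 ≤ n by omega),
    if_pos (show 2 ≤ n by omega), if_pos (show 3 ≤ n by omega), if_neg (show ¬n = 1 by omega),
    if_neg (show ¬n = 2 by omega), if_neg (show ¬n = 3 by omega)] at h
  rw [h, t1_eq_Tsum n (by omega), t1_eq_Tsum 1 le_rfl, t1_eq_Tsum 2 (by norm_num),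
    t1_eq_Tsum 3 (by norm_num), t1_eq_Tsum (n - 1) (by omega), t1_eq_Tsum (n - 2) (by omega),
    t1_eq_Tsum (n - 3) (by omega), h1, h2, h3]
  ring
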